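/- Let a be an idempotent two-sided ideal of S_n (a² = a) with a ≠ S_n. Then each prime ideal of S_n that is minimal over a is itself idempotent, and a is both the product and the intersection of the minimal primes over a: a = ∏_{P ∈ Min(a)} P = ⋂_{P ∈ Min(a)} P. Moreover this presentation is unique: if a is written as a product (respectively, as an intersection) of pairwise incomparable idempotent prime ideals q_1, …, q_s, then {q_1, …, q_s} = Min(a). -/

import Mathlib

set_option synthInstance.maxHeartbeats 1000000
set_option maxHeartbeats 1000000

open MvPolynomial

noncomputable section

/-- The polynomial algebra `P_n = K[x_1, …, x_n]`. -/
abbrev PolyAlg (K : Type u) [Field K] (n : ℕ) := MvPolynomial (Fin n) K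

/-- `X_i` : multiplication by the variable `x_i`, as a `K`-linear endomorphism of `P_n`. -/
def Xop (K : Type u) [Field K] (n : ℕ) (i : Fin n) : Module.End K (PolyAlg K n) :=
  LinearMap.mulLeft K (X i)

/-- `Y_i` : the left inverse of `X_i`, sending a monomial `x^α` to `x^{α - e_i}` if `α i ≥ 1`
and to `0` otherwise. -/
def Yop (K : Type u) [Field K] (n : ℕ) (i : Fin n) : Module.End K (PolyAlg K n) :=
  (basisMonomials (Fin n) K).constr K fun α =>
    if α i = 0 then 0 else monomial (α - Finsupp.single i 1) (1 : K)

/-- The algebra `S_n` of one-sided inverses of `P_n` : the subalgebra of `End_K(P_n)`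
generated by `X_1, …, X_n, Y_1, …, Y_n`. -/
def SnAlg (K : Type u) [Field K] (n : ℕ) : Subalgebra K (Module.End K (PolyAlg K n)) :=
  Algebra.adjoin K (Set.range (Xop K n) ∪ Set.range (Yop K n))

/-- `x_i` as an element of `S_n`. -/
def xS (K : Type u) [Field K] (n : ℕ) (i : Fin n) : SnAlg K n :=
  ⟨Xop K n i, Algebra.subset_adjoin (Set.mem_union_left _ ⟨i, rfl⟩)⟩

/-- `y_i` as an element of `S_n`. -/
def yS (K : Type u) [Field K] (n : ℕ) (i : Fin n) : SnAlg K n :=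
  ⟨Yop K n i, Algebra.subset_adjoin (Set.mem_union_right _ ⟨i, rfl⟩)⟩

/-- The product `I*J` of two two-sided ideals: the two-sided ideal generated by all products
`a * b` with `a ∈ I`, `b ∈ J`. -/
def tsiMul {R : Type*} [Ring R] (I J : TwoSidedIdeal R) : TwoSidedIdeal R :=
  TwoSidedIdeal.span {x | ∃ a ∈ I, ∃ b ∈ J, x = a * b}

/-- A two-sided ideal `P` of a ring is prime if it is proper and for all two-sided ideals
`I`, `J`, `I*J ⊆ P` implies `I ⊆ P` or `J ⊆ P`. -/
def tsiPrime {R : Type*} [Ring R] (P : TwoSidedIdeal R) : Prop :=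
  P ≠ ⊤ ∧ ∀ I J : TwoSidedIdeal R, tsiMul I J ≤ P → I ≤ P ∨ J ≤ P

/-- The set of prime two-sided ideals that are minimal among the primes containing `a`. -/
def minPrimesOver {R : Type*} [Ring R] (a : TwoSidedIdeal R) : Set (TwoSidedIdeal R) :=
  {P | tsiPrime P ∧ a ≤ P ∧ ∀ Q, tsiPrime Q → a ≤ Q → Q ≤ P → Q = P}

section TwoSidedIdeals

variable {R : Type*} [Ring R]

theorem span_induction_add {G : Set R} {p : R → Prop} (zero : p 0)
    (add : ∀ x y, p x → p y → p (x + y)) (neg : ∀ x, p x → p (-x))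
    (gen : ∀ g ∈ G, ∀ s t, p (s * g * t)) : ∀ u ∈ TwoSidedIdeal.span G, p u := by
  intro u hu
  rw [TwoSidedIdeal.mem_span_iff_mem_addSubgroup_closure] at hu
  induction hu using AddSubgroup.closure_induction with
  | mem x hx =>
    obtain ⟨y, ⟨s, -, g, hg, rfl⟩, t, -, rfl⟩ := hx
    exact gen g hg s t
  | zero => exact zero
  | add x y _ _ hx hy => exact add x y hx hy
  | neg x _ hx => exact neg x hx

theorem mul_mem_of_mem_span {G : Set R} {a : TwoSidedIdeal R} {f : R}
    (h : ∀ g ∈ G, ∀ s, f * s * g ∈ a) : ∀ u ∈ TwoSidedIdeal.span G, f * u ∈ a := by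
  refine span_induction_add (by simp) ?_ ?_ ?_
  · intro x y hx hy
    rw [mul_add]
    exact a.add_mem hx hy
  · intro x hx
    rw [mul_neg]
    exact a.neg_mem hx
  · intro g hg s t
    have := a.mul_mem_right _ t (h g hg s)
    simpa only [mul_assoc] using this

theorem mul_mem_tsiMul {I J : TwoSidedIdeal R} {x y : R} (hx : x ∈ I) (hy : y ∈ J) :
    x * y ∈ tsiMul I J :=
  TwoSidedIdeal.subset_span ⟨x, hx, y, hy, rfl⟩

theorem tsiMul_le_inf (I J : TwoSidedIdeal R) : tsiMul I J ≤ I ⊓ J := by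
  refine TwoSidedIdeal.span_le.2 ?_
  rintro _ ⟨x, hx, y, hy, rfl⟩
  exact (TwoSidedIdeal.mem_inf R).2 ⟨I.mul_mem_right _ _ hx, J.mul_mem_left _ _ hy⟩

/-- Every element of the ideal has a right unit inside the ideal. -/
def HasRightUnits (c : TwoSidedIdeal R) : Prop := ∀ f ∈ c, ∃ u ∈ c, f * u = f

theorem HasRightUnits.top : HasRightUnits (⊤ : TwoSidedIdeal R) :=
  fun f _ => ⟨1, TwoSidedIdeal.mem_top R, mul_one f⟩

theorem HasRightUnits.inf {c d : TwoSidedIdeal R} (hc : HasRightUnits c)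
    (hd : HasRightUnits d) : HasRightUnits (c ⊓ d) := by
  intro f hf
  rw [TwoSidedIdeal.mem_inf R] at hf
  obtain ⟨u, hu, hfu⟩ := hc f hf.1
  obtain ⟨v, hv, hfv⟩ := hd f hf.2
  exact ⟨u * v, (TwoSidedIdeal.mem_inf R).2 ⟨c.mul_mem_right _ _ hu, d.mul_mem_left _ _ hv⟩,
    by rw [← mul_assoc, hfu, hfv]⟩

theorem HasRightUnits.tsiMul_eq_inf {c d : TwoSidedIdeal R} (hd : HasRightUnits d) :
    tsiMul c d = c ⊓ d := by
  refine le_antisymm (tsiMul_le_inf c d) ?_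
  intro f hf
  obtain ⟨hfc, hfd⟩ := (TwoSidedIdeal.mem_inf R).1 hf
  obtain ⟨u, hu, hfu⟩ := hd f hfd
  rw [← hfu]
  exact mul_mem_tsiMul hfc hu

theorem HasRightUnits.foldr_tsiMul (l : List (TwoSidedIdeal R))
    (hl : ∀ q ∈ l, HasRightUnits q) :
    l.foldr tsiMul ⊤ = sInf {P | P ∈ l} ∧ HasRightUnits (sInf {P | P ∈ l}) := by
  induction l with
  | nil => simpa using HasRightUnits.top
  | cons q l ih =>
    obtain ⟨ih₁, ih₂⟩ := ih fun p hp => hl p (List.mem_cons_of_mem _ hp)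
    have hset : {P | P ∈ q :: l} = insert q {P | P ∈ l} := by
      ext P
      simp
    rw [List.foldr_cons, ih₁, hset, sInf_insert, ih₂.tsiMul_eq_inf]
    exact ⟨rfl, (hl q List.mem_cons_self).inf ih₂⟩

theorem tsiPrime.le_of_sInf_le {P : TwoSidedIdeal R} (hP : tsiPrime P)
    {s : Set (TwoSidedIdeal R)} (hs : s.Finite) (h : sInf s ≤ P) : ∃ q ∈ s, q ≤ P := by
  induction s, hs using Set.Finite.induction_on with
  | empty =>
    rw [sInf_empty, top_le_iff] at h
    exact absurd h hP.1
  | @insert q s _ _ ih =>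
    rw [sInf_insert] at h
    rcases hP.2 _ _ ((tsiMul_le_inf _ _).trans h) with h | h
    · exact ⟨q, Set.mem_insert _ _, h⟩
    · obtain ⟨p, hp, hpP⟩ := ih h
      exact ⟨p, Set.mem_insert_of_mem _ hp, hpP⟩

theorem setOf_mem_eq_minPrimesOver {l : List (TwoSidedIdeal R)} (hl : ∀ q ∈ l, tsiPrime q)
    (hinc : l.Pairwise fun p q => ¬ p ≤ q ∧ ¬ q ≤ p) :
    {P | P ∈ l} = minPrimesOver (sInf {P | P ∈ l}) := by
  have hfin : {P | P ∈ l}.Finite := List.finite_toSet l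
  ext P
  constructor
  · intro hP
    refine ⟨hl P hP, sInf_le hP, fun Q hQ hle hQP => ?_⟩
    obtain ⟨q, hq, hqQ⟩ := hQ.le_of_sInf_le hfin hle
    have hqP : q = P := by
      by_contra hne
      have : Std.Symm fun p q : TwoSidedIdeal R => ¬ p ≤ q ∧ ¬ q ≤ p := ⟨fun _ _ h => h.symm⟩
      have := hinc.forall hq hP hne
      exact this.1 (hqQ.trans hQP)
    exact le_antisymm hQP (hqP ▸ hqQ)
  · rintro ⟨hP, hle, hmin⟩
    obtain ⟨q, hq, hqP⟩ := hP.le_of_sInf_le hfin hle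
    rw [← hmin q (hl q hq) (sInf_le hq) hqP]
    exact hq

theorem minPrimesOver_of_sInf_primes {ι : Type*} [Finite ι] {Q : ι → TwoSidedIdeal R}
    (hprime : ∀ i, tsiPrime (Q i)) (hunits : ∀ i, HasRightUnits (Q i))
    (hinf : ∀ a, tsiMul a a = a → sInf {P | ∃ i, a ≤ Q i ∧ P = Q i} ≤ a)
    {a : TwoSidedIdeal R} (haidem : tsiMul a a = a) :
    (∀ P ∈ minPrimesOver a, tsiMul P P = P) ∧
    (∃ l : List (TwoSidedIdeal R), l.Nodup ∧ {P | P ∈ l} = minPrimesOver a ∧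
      a = l.foldr tsiMul ⊤) ∧
    a = sInf (minPrimesOver a) ∧
    (∀ l : List (TwoSidedIdeal R),
      (∀ q ∈ l, tsiPrime q ∧ tsiMul q q = q) →
      l.Pairwise (fun p q => ¬ p ≤ q ∧ ¬ q ≤ p) →
      a = l.foldr tsiMul ⊤ → {P | P ∈ l} = minPrimesOver a) ∧
    (∀ l : List (TwoSidedIdeal R),
      (∀ q ∈ l, tsiPrime q ∧ tsiMul q q = q) →
      l.Pairwise (fun p q => ¬ p ≤ q ∧ ¬ q ≤ p) →
      a = sInf {P | P ∈ l} → {P | P ∈ l} = minPrimesOver a) := by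
  have hfin : ∀ b : TwoSidedIdeal R, {P | ∃ i, b ≤ Q i ∧ P = Q i}.Finite := fun b =>
    (Set.finite_range Q).subset (by rintro _ ⟨i, -, rfl⟩; exact ⟨i, rfl⟩)
  have hexists : ∀ b P, tsiMul b b = b → tsiPrime P → b ≤ P → ∃ i, b ≤ Q i ∧ Q i ≤ P := by
    intro b P hb hP hbP
    obtain ⟨_, ⟨i, hi, rfl⟩, hiP⟩ := hP.le_of_sInf_le (hfin b) ((hinf b hb).trans hbP)
    exact ⟨i, hi, hiP⟩
  have hmin : ∀ P ∈ minPrimesOver a, ∃ i, a ≤ Q i ∧ P = Q i := by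
    rintro P ⟨hP, haP, hPmin⟩
    obtain ⟨i, hi, hiP⟩ := hexists a P haidem hP haP
    exact ⟨i, hi, (hPmin _ (hprime i) hi hiP).symm⟩
  have hminunits : ∀ P ∈ minPrimesOver a, HasRightUnits P := by
    intro P hP
    obtain ⟨i, -, rfl⟩ := hmin P hP
    exact hunits i
  have hminfin : (minPrimesOver a).Finite := (hfin a).subset hmin
  have hsInf : a = sInf (minPrimesOver a) := by
    refine le_antisymm (le_sInf fun P hP => hP.2.1) (le_trans (le_sInf ?_) (hinf a haidem))
    rintro _ ⟨i, hi, rfl⟩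
    obtain ⟨P, hPle, hP⟩ := (hfin a).exists_le_minimal ⟨i, hi, rfl⟩
    obtain ⟨⟨j, hj, rfl⟩, hPmin⟩ := hP
    refine (sInf_le ?_).trans hPle
    refine ⟨hprime j, hj, fun q hq haq hqj => ?_⟩
    obtain ⟨k, hk, hkq⟩ := hexists a q haidem hq haq
    exact le_antisymm hqj ((hPmin ⟨k, hk, rfl⟩ (hkq.trans hqj)).trans hkq)
  refine ⟨?_, ?_, hsInf, ?_, ?_⟩
  · intro P hP
    rw [(hminunits P hP).tsiMul_eq_inf, inf_idem]
  · refine ⟨hminfin.toFinset.toList, Finset.nodup_toList _, by ext; simp, ?_⟩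
    rw [(HasRightUnits.foldr_tsiMul _ fun q hq => hminunits q (by simpa using hq)).1]
    conv_lhs => rw [hsInf]
    congr 1
    ext
    simp
  · intro l hl hinc hal
    have hlunits : ∀ q ∈ l, HasRightUnits q := by
      intro q hq
      obtain ⟨i, hi, hiq⟩ := hexists q q (hl q hq).2 (hl q hq).1 le_rfl
      rw [le_antisymm hi hiq]
      exact hunits i
    rw [hal, (HasRightUnits.foldr_tsiMul l hlunits).1]
    exact setOf_mem_eq_minPrimesOver (fun q hq => (hl q hq).1) hinc
  · intro l hl hinc hal
    rw [hal]
    exact setOf_mem_eq_minPrimesOver (fun q hq => (hl q hq).1) hinc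

end TwoSidedIdeals

theorem Ideal.eq_bot_or_exists_pow_mem {A : Type*} [CommRing A] [IsDomain A]
    [IsNoetherianRing A] {j : Ideal A} {z : A} (hz : z ≠ 0)
    (h : ∀ q ∈ j, ∃ N : ℕ, z ^ N * q ∈ j * j) : j = ⊥ ∨ ∃ N : ℕ, z ^ N ∈ j := by
  have hle : Submonoid.powers z ≤ nonZeroDivisors A := powers_le_nonZeroDivisors_of_noZeroDivisors hz
  have : IsDomain (Localization.Away z) := IsLocalization.isDomain_localization hle
  have : IsNoetherianRing (Localization.Away z) :=
    IsLocalization.isNoetherianRing (Submonoid.powers z) _ inferInstance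
  have hidem : IsIdempotentElem (j.map (algebraMap A (Localization.Away z))) := by
    refine le_antisymm Ideal.mul_le_left ?_
    rw [← Ideal.map_mul]
    refine Ideal.map_le_iff_le_comap.2 fun q hq => ?_
    obtain ⟨N, hN⟩ := h q hq
    have hu : IsUnit (algebraMap A (Localization.Away z) (z ^ N)) :=
      IsLocalization.map_units _ (⟨z ^ N, N, rfl⟩ : Submonoid.powers z)
    have := Ideal.mem_map_of_mem (algebraMap A (Localization.Away z)) hN
    rw [map_mul] at this
    exact (Ideal.unit_mul_mem_iff_mem _ hu).1 this
  rcases (Ideal.isIdempotentElem_iff_eq_bot_or_top _ (IsNoetherian.noetherian _)).1 hidem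
    with h | h
  · left
    exact (Ideal.map_eq_bot_iff_of_injective (IsLocalization.injective _ hle)).1 h
  · right
    by_contra hne
    push Not at hne
    refine (IsLocalization.map_algebraMap_ne_top_iff_disjoint (Submonoid.powers z)
      (Localization.Away z) j).2 ?_ h
    rw [Set.disjoint_left]
    rintro _ ⟨N, rfl⟩ hN
    exact hne N hN

section OneSidedInverses

variable {K : Type*} [Field K] {n : ℕ}

/-- The ring structure of `S_n`, found without unfolding the subalgebra. -/
local instance instRingSnAlg : Ring (SnAlg K n) := Subalgebra.toRing _

theorem SnAlg_ext {f g : SnAlg K n} (h : ∀ p, f.1 p = g.1 p) : f = g :=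
  Subtype.ext (LinearMap.ext h)

theorem SnAlg_mul_apply (f g : SnAlg K n) (p : PolyAlg K n) : (f * g).1 p = f.1 (g.1 p) := rfl

theorem SnAlg_one_apply (p : PolyAlg K n) : (1 : SnAlg K n).1 p = p := rfl

theorem SnAlg_sub_apply (f g : SnAlg K n) (p : PolyAlg K n) : (f - g).1 p = f.1 p - g.1 p := rfl

theorem xS_apply (i : Fin n) (p : PolyAlg K n) : (xS K n i).1 p = X i * p := rfl

theorem SnAlg_induction {p : SnAlg K n → Prop} (x : ∀ i, p (xS K n i)) (y : ∀ i, p (yS K n i))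
    (algebraMap : ∀ r, p (algebraMap K (SnAlg K n) r)) (add : ∀ f g, p f → p g → p (f + g))
    (mul : ∀ f g, p f → p g → p (f * g)) (f : SnAlg K n) : p f := by
  obtain ⟨f, hf⟩ := f
  refine Algebra.adjoin_induction (p := fun f hf => p ⟨f, hf⟩) ?_ algebraMap
    (fun f g hf hg => add ⟨f, hf⟩ ⟨g, hg⟩) (fun f g hf hg => mul ⟨f, hf⟩ ⟨g, hg⟩) hf
  rintro _ (⟨i, rfl⟩ | ⟨i, rfl⟩)
  · exact x i
  · exact y i

theorem coeff_yS (i : Fin n) (p : PolyAlg K n) (d : Fin n →₀ ℕ) :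
    coeff d ((yS K n i).1 p) = coeff (d + Finsupp.single i 1) p := by
  change coeff d (Yop K n i p) = _
  induction p using MvPolynomial.induction_on' with
  | add p q hp hq => rw [map_add, coeff_add, coeff_add, hp, hq]
  | monomial b c =>
    have hb : monomial b c = c • (basisMonomials (Fin n) K) b := by
      simp [coe_basisMonomials, smul_monomial]
    rw [hb, map_smul, Yop, Module.Basis.constr_basis, coeff_smul, coeff_smul, coe_basisMonomials,
      coeff_monomial]
    congr 1
    split_ifs with h0 h1 h1
    · subst h1
      simp at h0
    · simp
    · subst h1
      simp
    · rw [coeff_monomial, if_neg]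
      rintro rfl
      refine h1 (tsub_add_cancel_of_le ?_).symm
      simpa [Nat.one_le_iff_ne_zero] using h0

/-- Multiplication by a polynomial, as an element of `S_n`. -/
def mulS (K : Type*) [Field K] (n : ℕ) : PolyAlg K n →ₐ[K] SnAlg K n :=
  (Algebra.lmul K (PolyAlg K n)).codRestrict (SnAlg K n) fun p => by
    induction p using MvPolynomial.induction_on with
    | C a =>
      rw [← algebraMap_eq, AlgHom.commutes]
      exact Subalgebra.algebraMap_mem _ a
    | add p q hp hq =>
      rw [map_add]
      exact add_mem hp hq
    | mul_X p i hp =>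
      rw [map_mul]
      exact mul_mem hp (xS K n i).2

theorem mulS_X (i : Fin n) : mulS K n (X i) = xS K n i := rfl

theorem yS_mul_xS (i : Fin n) : yS K n i * xS K n i = 1 := by
  refine SnAlg_ext fun p => MvPolynomial.ext _ _ fun d => ?_
  rw [SnAlg_mul_apply, SnAlg_one_apply, xS_apply, coeff_yS, add_comm, coeff_X_mul]

theorem commute_xS_xS (i j : Fin n) : Commute (xS K n i) (xS K n j) := by
  rw [← mulS_X, ← mulS_X]
  exact (Commute.all (X i) (X j)).map (mulS K n)

theorem commute_yS_xS {i j : Fin n} (h : i ≠ j) : Commute (yS K n i) (xS K n j) := by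
  refine SnAlg_ext fun p => MvPolynomial.ext _ _ fun d => ?_
  have hs : j ∈ (d + Finsupp.single i 1).support ↔ j ∈ d.support := by
    simp [h]
  rw [SnAlg_mul_apply, SnAlg_mul_apply, xS_apply, xS_apply, coeff_yS, coeff_X_mul', coeff_X_mul',
    coeff_yS]
  simp only [hs]
  split_ifs with hj
  · congr 1
    refine tsub_add_eq_add_tsub ?_ |>.symm
    simpa [Nat.one_le_iff_ne_zero] using hj
  · rfl

/-- The idempotent `1 - x_i y_i`. -/
def eS (K : Type*) [Field K] (n : ℕ) (i : Fin n) : SnAlg K n := 1 - xS K n i * yS K n i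

theorem eS_mul_xS (i : Fin n) : eS K n i * xS K n i = 0 := by
  rw [eS, sub_mul, one_mul, mul_assoc, yS_mul_xS, mul_one, sub_self]

theorem commute_eS_xS {i j : Fin n} (h : i ≠ j) : Commute (eS K n i) (xS K n j) :=
  (Commute.one_left _).sub_left ((commute_xS_xS i j).mul_left (commute_yS_xS h))

theorem coeff_eS (i : Fin n) (p : PolyAlg K n) (d : Fin n →₀ ℕ) :
    coeff d ((eS K n i).1 p) = if d i = 0 then coeff d p else 0 := by
  rw [eS, SnAlg_sub_apply, SnAlg_one_apply, SnAlg_mul_apply, xS_apply, coeff_sub, coeff_X_mul']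
  simp only [Finsupp.mem_support_iff, ite_not]
  split_ifs with h
  · simp
  · rw [coeff_yS, tsub_add_cancel_of_le, sub_self]
    simpa [Nat.one_le_iff_ne_zero] using h

/-- The substitution `x_i ↦ 0` for `i ∈ I`. -/
def substZero (K : Type*) [Field K] {n : ℕ} (I : Finset (Fin n)) : PolyAlg K n →ₐ[K] PolyAlg K n :=
  aeval fun i => if i ∈ I then 0 else X i

theorem eS_apply (i : Fin n) (p : PolyAlg K n) : (eS K n i).1 p = substZero K {i} p := by
  induction p using MvPolynomial.induction_on with
  | C a =>
    refine MvPolynomial.ext _ _ fun d => ?_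
    rw [coeff_eS, ← algebraMap_eq, AlgHom.commutes, algebraMap_eq, coeff_C]
    split_ifs with h1 h2 h2
    · rfl
    · rfl
    · subst h2
      exact absurd rfl h1
    · rfl
  | add p q hp hq => rw [map_add, map_add, hp, hq]
  | mul_X p j hp =>
    rw [map_mul (substZero K {i}), ← hp, mul_comm p, ← xS_apply, ← SnAlg_mul_apply]
    by_cases h : i = j
    · subst h
      rw [eS_mul_xS]
      simp [substZero]
    · rw [(commute_eS_xS h).eq, SnAlg_mul_apply, xS_apply, mul_comm]
      simp [substZero, Ne.symm h]

theorem substZero_comp_substZero (I J : Finset (Fin n)) :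
    (substZero K I).comp (substZero K J) = substZero K (I ∪ J) := by
  refine MvPolynomial.algHom_ext fun j => ?_
  by_cases hI : j ∈ I <;> by_cases hJ : j ∈ J <;> simp [substZero, hI, hJ]

theorem substZero_empty : substZero K (∅ : Finset (Fin n)) = AlgHom.id K _ := by
  refine MvPolynomial.algHom_ext fun j => ?_
  simp [substZero]

theorem substZero_mem_SnAlg (I : Finset (Fin n)) : (substZero K I).toLinearMap ∈ SnAlg K n := by
  induction I using Finset.induction_on with
  | empty =>
    rw [substZero_empty]
    exact one_mem (SnAlg K n)
  | insert i I _ ih =>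
    convert mul_mem (eS K n i).2 ih using 1
    refine LinearMap.ext fun p => ?_
    rw [Finset.insert_eq, ← substZero_comp_substZero]
    exact (eS_apply i _).symm

/-- The product of the idempotents `1 - x_i y_i` for `i ∈ I`. -/
def eProd (K : Type*) [Field K] {n : ℕ} (I : Finset (Fin n)) : SnAlg K n :=
  ⟨(substZero K I).toLinearMap, substZero_mem_SnAlg I⟩

@[simp]
theorem eProd_apply (I : Finset (Fin n)) (p : PolyAlg K n) :
    (eProd K I).1 p = substZero K I p := rfl

theorem eProd_empty : eProd K (∅ : Finset (Fin n)) = 1 :=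
  SnAlg_ext fun p => by rw [eProd_apply, substZero_empty]; rfl

theorem substZero_substZero (I : Finset (Fin n)) (p : PolyAlg K n) :
    substZero K I (substZero K I p) = substZero K I p := by
  have := DFunLike.congr_fun (substZero_comp_substZero (K := K) I I) p
  rwa [Finset.union_self] at this

theorem eProd_mul_eProd (I J : Finset (Fin n)) : eProd K I * eProd K J = eProd K (I ∪ J) :=
  SnAlg_ext fun p => DFunLike.congr_fun (substZero_comp_substZero I J) p

theorem eProd_mul_self (I : Finset (Fin n)) : eProd K I * eProd K I = eProd K I := by
  rw [eProd_mul_eProd, Finset.union_self]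

theorem eProd_singleton (i : Fin n) : eProd K {i} = eS K n i :=
  SnAlg_ext fun p => (eS_apply i p).symm

theorem eProd_mul_mulS (I : Finset (Fin n)) (p : PolyAlg K n) :
    eProd K I * mulS K n p = mulS K n (substZero K I p) * eProd K I :=
  SnAlg_ext fun q => map_mul (substZero K I) p q

theorem coeff_substZero (I : Finset (Fin n)) (p : PolyAlg K n) (d : Fin n →₀ ℕ) :
    coeff d (substZero K I p) = if ∀ i ∈ I, d i = 0 then coeff d p else 0 := by
  induction I using Finset.induction_on with
  | empty => simp [substZero_empty]
  | insert i I _ ih =>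
    rw [Finset.insert_eq, ← substZero_comp_substZero, AlgHom.comp_apply]
    rw [← eS_apply, coeff_eS, ih]
    by_cases hi : d i = 0 <;> simp [hi]

/-- The product of the variables `x_j` for `j ∉ I`. -/
def varProd (K : Type*) [Field K] {n : ℕ} (I : Finset (Fin n)) : PolyAlg K n := ∏ j ∈ Iᶜ, X j

theorem varProd_ne_zero (I : Finset (Fin n)) : varProd K I ≠ 0 :=
  Finset.prod_ne_zero_iff.2 fun j _ => X_ne_zero j

theorem substZero_varProd (I : Finset (Fin n)) : substZero K I (varProd K I) = varProd K I := by
  rw [varProd, map_prod]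
  refine Finset.prod_congr rfl fun j hj => ?_
  simp [substZero, Finset.mem_compl.1 hj]

theorem eProd_mul_mulS_of_fixed {I : Finset (Fin n)} {p : PolyAlg K n}
    (hp : substZero K I p = p) : eProd K I * mulS K n p = mulS K n p * eProd K I := by
  rw [eProd_mul_mulS, hp]

theorem substZero_varProd_pow (I : Finset (Fin n)) (N : ℕ) :
    substZero K I (varProd K I ^ N) = varProd K I ^ N := by
  rw [map_pow, substZero_varProd]

theorem commute_mulS_of_fixed {I : Finset (Fin n)} {f : SnAlg K n}
    (hf : ∀ j ∉ I, Commute f (xS K n j)) {p : PolyAlg K n} (hp : substZero K I p = p) :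
    Commute f (mulS K n p) := by
  rw [← hp]
  clear hp
  induction p using MvPolynomial.induction_on with
  | C a =>
    rw [← algebraMap_eq, AlgHom.commutes, AlgHom.commutes]
    exact (Algebra.commutes a f).symm
  | add p q hp hq =>
    rw [map_add, map_add]
    exact hp.add_right hq
  | mul_X p j hp =>
    rw [map_mul, map_mul]
    refine hp.mul_right ?_
    by_cases hj : j ∈ I
    · simp [substZero, hj]
    · simpa [substZero, hj, mulS_X] using hf j hj

theorem exists_commute_mul_varProd_pow (I : Finset (Fin n)) (f : SnAlg K n) :
    ∃ N : ℕ, ∀ j ∉ I, Commute (f * mulS K n (varProd K I ^ N)) (xS K n j) := by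
  have hpow : ∀ (N : ℕ) (j : Fin n), Commute (mulS K n (varProd K I ^ N)) (xS K n j) := by
    intro N j
    rw [← mulS_X]
    exact (Commute.all _ _).map (mulS K n)
  induction f using SnAlg_induction with
  | x i => exact ⟨0, fun j _ => (commute_xS_xS i j).mul_left (hpow 0 j)⟩
  | y i =>
    by_cases hi : i ∈ I
    · refine ⟨0, fun j hj => (commute_yS_xS ?_).mul_left (hpow 0 j)⟩
      rintro rfl
      exact hj hi
    · refine ⟨1, fun j _ => ?_⟩
      rw [pow_one, varProd, ← Finset.mul_prod_erase Iᶜ _ (Finset.mem_compl.2 hi), map_mul, mulS_X,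
        ← mul_assoc, yS_mul_xS, one_mul, ← mulS_X]
      exact (Commute.all _ _).map (mulS K n)
  | algebraMap r =>
    have hr : ∀ j, Commute (algebraMap K (SnAlg K n) r) (xS K n j) := fun j =>
      Algebra.commutes r (xS K n j)
    exact ⟨0, fun j _ => (hr j).mul_left (hpow 0 j)⟩
  | add f g hf hg =>
    obtain ⟨N, hN⟩ := hf
    obtain ⟨M, hM⟩ := hg
    refine ⟨N + M, fun j hj => ?_⟩
    rw [add_mul]
    refine Commute.add_left ?_ ?_
    · rw [pow_add, map_mul, ← mul_assoc]
      exact (hN j hj).mul_left (hpow M j)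
    · rw [add_comm, pow_add, map_mul, ← mul_assoc]
      exact (hM j hj).mul_left (hpow N j)
  | mul f g hf hg =>
    obtain ⟨N, hN⟩ := hf
    obtain ⟨M, hM⟩ := hg
    refine ⟨M + N, fun j hj => ?_⟩
    have := (commute_mulS_of_fixed hM (substZero_varProd_pow I N)).eq
    rw [pow_add, map_mul, ← mul_assoc, mul_assoc f, mul_assoc f, this, ← mul_assoc]
    exact (hN j hj).mul_left (hM j hj)

theorem eProd_mul_mul_eProd {I : Finset (Fin n)} {f : SnAlg K n}
    (hf : ∀ j ∉ I, Commute f (xS K n j)) :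
    eProd K I * f * eProd K I = mulS K n (substZero K I (f.1 1)) * eProd K I := by
  refine SnAlg_ext fun p => ?_
  have := (commute_mulS_of_fixed hf (substZero_substZero I p)).eq
  have h1 := DFunLike.congr_fun (congrArg Subtype.val this) (1 : PolyAlg K n)
  change f.1 (substZero K I p * 1) = substZero K I p * f.1 1 at h1
  change substZero K I (f.1 (substZero K I p)) = substZero K I (f.1 1) * substZero K I p
  rw [mul_one] at h1
  rw [h1, map_mul, substZero_substZero, mul_comm]

theorem mulS_mul_eProd_injective {I : Finset (Fin n)} {p q : PolyAlg K n}
    (h : mulS K n p * eProd K I = mulS K n q * eProd K I) : p = q := by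
  have := DFunLike.congr_fun (congrArg Subtype.val h) (1 : PolyAlg K n)
  change p * substZero K I 1 = q * substZero K I 1 at this
  simpa using this

theorem exists_coeff_shift {I : Finset (Fin n)} (b : Fin n →₀ ℕ) (hb : ∀ j ∉ I, b j = 0) :
    ∃ w : SnAlg K n, (∀ j ∉ I, Commute w (xS K n j)) ∧
      ∀ p d, coeff d (w.1 p) = coeff (d + b) p := by
  induction b using Finsupp.induction_linear with
  | zero => exact ⟨1, fun j _ => Commute.one_left _, fun p d => by simp⟩
  | add b c ihb ihc =>
    obtain ⟨w, hw, hw'⟩ := ihb fun j hj => by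
      have := hb j hj
      simp at this
      exact this.1
    obtain ⟨v, hv, hv'⟩ := ihc fun j hj => by
      have := hb j hj
      simp at this
      exact this.2
    refine ⟨w * v, fun j hj => (hw j hj).mul_left (hv j hj), fun p d => ?_⟩
    rw [SnAlg_mul_apply, hw', hv', add_assoc]
  | single i k =>
    rcases Nat.eq_zero_or_pos k with rfl | hk
    · exact ⟨1, fun j _ => Commute.one_left _, fun p d => by simp⟩
    have hi : ∀ j ∉ I, i ≠ j := by
      rintro j hj rfl
      have := hb i hj
      simp at this
      omega
    clear hb hk
    induction k with
    | zero => exact ⟨1, fun j _ => Commute.one_left _, fun p d => by simp⟩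
    | succ k ih =>
      obtain ⟨w, hw, hw'⟩ := ih
      refine ⟨w * yS K n i, fun j hj => (hw j hj).mul_left (commute_yS_xS (hi j hj)),
        fun p d => ?_⟩
      rw [SnAlg_mul_apply, hw', coeff_yS, add_assoc, ← Finsupp.single_add]

/-- The ideal of `S_n` generated by the idempotents `1 - x_j y_j` for `j ∉ I`. -/
def outerIdeal (K : Type*) [Field K] {n : ℕ} (I : Finset (Fin n)) : TwoSidedIdeal (SnAlg K n) :=
  TwoSidedIdeal.span {g | ∃ j ∉ I, g = eS K n j}

theorem eS_mem_outerIdeal {I : Finset (Fin n)} {j : Fin n} (hj : j ∉ I) :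
    eS K n j ∈ outerIdeal K I :=
  TwoSidedIdeal.subset_span ⟨j, hj, rfl⟩

theorem exists_mul_varProd_pow_eq_zero {I : Finset (Fin n)} {f : SnAlg K n}
    (hf : f ∈ outerIdeal K I) : ∃ N : ℕ, f * mulS K n (varProd K I ^ N) = 0 := by
  refine span_induction_add (p := fun f => ∃ N : ℕ, f * mulS K n (varProd K I ^ N) = 0)
    ⟨0, by simp⟩ ?_ ?_ ?_ f hf
  · rintro f g ⟨N, hN⟩ ⟨M, hM⟩
    refine ⟨N + M, ?_⟩
    have h1 : f * mulS K n (varProd K I ^ (N + M)) = 0 := by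
      rw [pow_add, map_mul, ← mul_assoc, hN, zero_mul]
    have h2 : g * mulS K n (varProd K I ^ (N + M)) = 0 := by
      rw [add_comm, pow_add, map_mul, ← mul_assoc, hM, zero_mul]
    rw [add_mul, h1, h2, add_zero]
  · rintro f ⟨N, hN⟩
    exact ⟨N, by rw [neg_mul, hN, neg_zero]⟩
  · rintro _ ⟨j, hj, rfl⟩ s t
    obtain ⟨N, hN⟩ := exists_commute_mul_varProd_pow I t
    have he : eS K n j * mulS K n (varProd K I) = 0 := by
      rw [varProd, ← Finset.mul_prod_erase Iᶜ _ (Finset.mem_compl.2 hj), map_mul, mulS_X,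
        ← mul_assoc, eS_mul_xS, zero_mul]
    refine ⟨N + 1, ?_⟩
    rw [pow_succ, map_mul, mul_assoc (s * _), ← mul_assoc t,
      (commute_mulS_of_fixed hN (substZero_varProd I)).eq, mul_assoc s, ← mul_assoc (eS K n j), he,
      zero_mul, mul_zero]

theorem exists_mulS_varProd_pow_mul_eq_one (I : Finset (Fin n)) (N : ℕ) :
    ∃ v : SnAlg K n, v * mulS K n (varProd K I ^ N) = 1 ∧
      1 - mulS K n (varProd K I ^ N) * v ∈ outerIdeal K I := by
  have hmul : ∀ p q : PolyAlg K n,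
      (∃ v, v * mulS K n p = 1 ∧ 1 - mulS K n p * v ∈ outerIdeal K I) →
      (∃ v, v * mulS K n q = 1 ∧ 1 - mulS K n q * v ∈ outerIdeal K I) →
      ∃ v, v * mulS K n (p * q) = 1 ∧ 1 - mulS K n (p * q) * v ∈ outerIdeal K I := by
    rintro p q ⟨v, hv, hv'⟩ ⟨w, hw, hw'⟩
    refine ⟨w * v, ?_, ?_⟩
    · rw [map_mul, mul_assoc, ← mul_assoc v, hv, one_mul, hw]
    · have := (outerIdeal K I).add_mem hv' ((outerIdeal K I).mul_mem_left (mulS K n p) _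
        ((outerIdeal K I).mul_mem_right _ v hw'))
      convert this using 1
      rw [map_mul]
      noncomm_ring
  have hone : ∃ v, v * mulS K n (1 : PolyAlg K n) = 1 ∧
      1 - mulS K n (1 : PolyAlg K n) * v ∈ outerIdeal K I :=
    ⟨1, by simp, by simp⟩
  have hprod : ∃ v, v * mulS K n (varProd K I) = 1 ∧
      1 - mulS K n (varProd K I) * v ∈ outerIdeal K I := by
    refine Finset.prod_induction _ (fun p => ∃ v, v * mulS K n p = 1 ∧
      1 - mulS K n p * v ∈ outerIdeal K I) hmul hone fun j hj => ?_
    exact ⟨yS K n j, yS_mul_xS j, eS_mem_outerIdeal (Finset.mem_compl.1 hj)⟩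
  induction N with
  | zero => simp
  | succ N ih =>
    rw [pow_succ]
    exact hmul _ _ ih hprod

theorem hasRightUnits_outerIdeal (I : Finset (Fin n)) : HasRightUnits (outerIdeal K I) := by
  intro f hf
  obtain ⟨N, hN⟩ := exists_mul_varProd_pow_eq_zero hf
  obtain ⟨v, -, hv⟩ := exists_mulS_varProd_pow_mul_eq_one (K := K) I N
  exact ⟨_, hv, by rw [mul_sub, mul_one, ← mul_assoc, hN, zero_mul, sub_zero]⟩

theorem mem_outerIdeal_of_mul_mem {I : Finset (Fin n)} {f : SnAlg K n} {N : ℕ}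
    (h : f * mulS K n (varProd K I ^ N) ∈ outerIdeal K I) : f ∈ outerIdeal K I := by
  obtain ⟨v, -, hv⟩ := exists_mulS_varProd_pow_mul_eq_one (K := K) I N
  convert (outerIdeal K I).add_mem ((outerIdeal K I).mul_mem_left f _ hv)
    ((outerIdeal K I).mul_mem_right _ v h) using 1
  noncomm_ring

theorem exists_mul_mul_eq_of_notMem_outerIdeal {I : Finset (Fin n)} {f : SnAlg K n}
    (hf : f ∉ outerIdeal K I) :
    ∃ s t q, s * f * t = mulS K n q * eProd K I ∧ substZero K I q = q ∧ q ≠ 0 := by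
  obtain ⟨N, hN⟩ := exists_commute_mul_varProd_pow I f
  set g := f * mulS K n (varProd K I ^ N) with hg
  have hg0 : g ≠ 0 := by
    intro h
    exact hf (mem_outerIdeal_of_mul_mem (N := N) (by rw [← hg, h]; exact TwoSidedIdeal.zero_mem _))
  obtain ⟨p, hp⟩ : ∃ p, g.1 p ≠ 0 := by
    by_contra! h
    exact hg0 (SnAlg_ext h)
  obtain ⟨d, hd⟩ := MvPolynomial.ne_zero_iff.1 hp
  obtain ⟨w, hw, hw'⟩ := exists_coeff_shift (K := K) (d.filter (· ∈ I)) (I := I)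
    fun j hj => by simp [hj]
  have hcomm : ∀ j ∉ I, Commute (w * g * mulS K n p) (xS K n j) := by
    intro j hj
    refine ((hw j hj).mul_left (hN j hj)).mul_left ?_
    rw [← mulS_X]
    exact (Commute.all _ _).map (mulS K n)
  refine ⟨eProd K I * w, mulS K n (varProd K I ^ N) * mulS K n p * eProd K I,
    substZero K I ((w * g * mulS K n p).1 1), ?_, substZero_substZero I _, ?_⟩
  · rw [← eProd_mul_mul_eProd hcomm, hg]
    noncomm_ring
  · refine MvPolynomial.ne_zero_iff.2 ⟨d.filter (· ∉ I), ?_⟩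
    rw [coeff_substZero, if_pos fun i hi => by simp [hi]]
    change coeff _ (w.1 (g.1 (p * 1))) ≠ 0
    rw [mul_one, hw', add_comm, Finsupp.filter_add_filter_not]
    exact hd

theorem mulS_mul_eProd_notMem_outerIdeal {I : Finset (Fin n)} {q : PolyAlg K n} (hq : q ≠ 0) :
    mulS K n q * eProd K I ∉ outerIdeal K I := by
  intro h
  obtain ⟨N, hN⟩ := exists_mul_varProd_pow_eq_zero h
  rw [mul_assoc, eProd_mul_mulS_of_fixed (substZero_varProd_pow I N), ← mul_assoc, ← map_mul] at hN
  have h0 : mulS K n (q * varProd K I ^ N) * eProd K I = mulS K n 0 * eProd K I := by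
    rw [hN, map_zero, zero_mul]
  exact mul_ne_zero hq (pow_ne_zero N (varProd_ne_zero I)) (mulS_mul_eProd_injective h0)

theorem tsiPrime_outerIdeal (I : Finset (Fin n)) : tsiPrime (outerIdeal K I) := by
  refine ⟨fun h => ?_, fun A B hAB => ?_⟩
  · refine mulS_mul_eProd_notMem_outerIdeal (K := K) (I := I) one_ne_zero ?_
    rw [h]
    exact TwoSidedIdeal.mem_top _
  · by_contra! hne
    obtain ⟨f, hfA, hf⟩ := SetLike.not_le_iff_exists.1 hne.1
    obtain ⟨g, hgB, hg⟩ := SetLike.not_le_iff_exists.1 hne.2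
    obtain ⟨s, t, p, hp, hp', hp0⟩ := exists_mul_mul_eq_of_notMem_outerIdeal hf
    obtain ⟨s', t', q, hq, hq', hq0⟩ := exists_mul_mul_eq_of_notMem_outerIdeal hg
    have hpA : mulS K n p * eProd K I ∈ A := hp ▸ A.mul_mem_right _ _ (A.mul_mem_left _ _ hfA)
    have hqB : mulS K n q * eProd K I ∈ B := hq ▸ B.mul_mem_right _ _ (B.mul_mem_left _ _ hgB)
    refine mulS_mul_eProd_notMem_outerIdeal (mul_ne_zero hp0 hq0) ?_ (I := I)
    convert hAB (mul_mem_tsiMul hpA hqB) using 1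
    rw [mul_assoc, ← mul_assoc (eProd K I), eProd_mul_mulS_of_fixed hq', mul_assoc (mulS K n q),
      eProd_mul_self, ← mul_assoc, map_mul]


/-- The intersection of the ideals of `S_n` generated by `1 - x_i y_i`, for `i ∈ I`. -/
def innerIdeal (K : Type*) [Field K] {n : ℕ} (I : Finset (Fin n)) : TwoSidedIdeal (SnAlg K n) :=
  I.inf fun i => outerIdeal K {i}ᶜ

theorem innerIdeal_insert (i : Fin n) (I : Finset (Fin n)) :
    innerIdeal K (insert i I) = outerIdeal K {i}ᶜ ⊓ innerIdeal K I :=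
  Finset.inf_insert

theorem hasRightUnits_innerIdeal (I : Finset (Fin n)) : HasRightUnits (innerIdeal K I) := by
  induction I using Finset.induction_on with
  | empty => exact HasRightUnits.top
  | insert i I _ ih =>
    rw [innerIdeal_insert]
    exact (hasRightUnits_outerIdeal _).inf ih

theorem eProd_mem_innerIdeal (I : Finset (Fin n)) : eProd K I ∈ innerIdeal K I := by
  suffices h : ∀ J ⊆ I, eProd K I ∈ innerIdeal K J from h I subset_rfl
  intro J hJ
  induction J using Finset.induction_on with
  | empty => exact TwoSidedIdeal.mem_top _
  | insert i J _ ih =>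
    rw [innerIdeal_insert, TwoSidedIdeal.mem_inf]
    refine ⟨?_, ih ((Finset.subset_insert i J).trans hJ)⟩
    have hi : i ∈ I := hJ (Finset.mem_insert_self i J)
    rw [← Finset.union_eq_left.2 (Finset.singleton_subset_iff.2 hi), ← eProd_mul_eProd,
      eProd_singleton]
    exact (outerIdeal K {i}ᶜ).mul_mem_left _ _ (eS_mem_outerIdeal (by simp))

theorem mul_eProd_mem_span {I : Finset (Fin n)} {f : SnAlg K n} (hf : f ∈ innerIdeal K I)
    (J : Finset (Fin n)) : f * eProd K J ∈ TwoSidedIdeal.span {eProd K (I ∪ J)} := by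
  induction I using Finset.induction_on generalizing f J with
  | empty =>
    rw [Finset.empty_union]
    exact TwoSidedIdeal.mul_mem_left _ _ _ (TwoSidedIdeal.subset_span rfl)
  | insert i I _ ih =>
    rw [innerIdeal_insert, TwoSidedIdeal.mem_inf] at hf
    by_cases hi : i ∈ J
    · rw [Finset.insert_union, Finset.insert_eq_of_mem (Finset.mem_union_right I hi)]
      exact ih hf.2 J
    set c := TwoSidedIdeal.span {eProd K (insert i I ∪ J)} with hc
    have hpow : ∀ k, f * eProd K J * mulS K n (X i ^ k) = f * mulS K n (X i ^ k) * eProd K J := by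
      intro k
      rw [mul_assoc, eProd_mul_mulS_of_fixed, ← mul_assoc]
      simp [substZero, hi]
    have hstep : ∀ k, f * eProd K J * mulS K n (X i ^ k) ∈ c → f * eProd K J ∈ c := by
      intro k
      induction k with
      | zero => simp
      | succ k ihk =>
        refine fun hk => ihk ?_
        have hJ : f * eProd K J * mulS K n (X i ^ k) * eS K n i ∈ c := by
          rw [hpow, mul_assoc, ← eProd_singleton, eProd_mul_eProd, hc, Finset.insert_union,
            ← Finset.union_insert, Finset.insert_eq, Finset.union_comm {i} J]
          exact ih (TwoSidedIdeal.mul_mem_right _ _ _ hf.2) _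
        convert c.add_mem (c.mul_mem_right _ (yS K n i) hk) hJ using 1
        rw [pow_succ, map_mul, mulS_X, eS]
        noncomm_ring
    obtain ⟨N, hN⟩ := exists_mul_varProd_pow_eq_zero hf.1
    refine hstep N ?_
    rw [varProd, compl_compl, Finset.prod_singleton] at hN
    rw [hpow, hN, zero_mul]
    exact c.zero_mem

theorem innerIdeal_le_span (I : Finset (Fin n)) :
    innerIdeal K I ≤ TwoSidedIdeal.span {eProd K I} := by
  intro f hf
  simpa [eProd_empty] using mul_eProd_mem_span hf ∅

/-- The ideal of the polynomials `q` in the variables outside `I` with `q * eProd K I ∈ a`. -/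
def coeffIdeal (a : TwoSidedIdeal (SnAlg K n)) (I : Finset (Fin n)) :
    Ideal (substZero K I).range where
  carrier := {q | mulS K n q.1 * eProd K I ∈ a}
  zero_mem' := by
    change mulS K n 0 * eProd K I ∈ a
    rw [map_zero, zero_mul]
    exact a.zero_mem
  add_mem' {p q} hp hq := by
    change mulS K n (p.1 + q.1) * eProd K I ∈ a
    rw [map_add, add_mul]
    exact a.add_mem hp hq
  smul_mem' p q hq := by
    change mulS K n (p.1 * q.1) * eProd K I ∈ a
    rw [map_mul, mul_assoc]
    exact a.mul_mem_left _ _ hq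

theorem mem_coeffIdeal {a : TwoSidedIdeal (SnAlg K n)} {I : Finset (Fin n)}
    {q : (substZero K I).range} : q ∈ coeffIdeal a I ↔ mulS K n q.1 * eProd K I ∈ a := Iff.rfl

theorem substZero_of_mem_range {I : Finset (Fin n)} (q : (substZero K I).range) :
    substZero K I q.1 = q.1 := by
  obtain ⟨_, p, rfl⟩ := q
  exact substZero_substZero I p

theorem exists_corner_eq {a : TwoSidedIdeal (SnAlg K n)} (I : Finset (Fin n)) {f : SnAlg K n}
    (hf : f ∈ a) : ∃ N, ∃ q ∈ coeffIdeal a I,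
      eProd K I * f * eProd K I * mulS K n (varProd K I ^ N) = mulS K n q.1 * eProd K I := by
  obtain ⟨N, hN⟩ := exists_commute_mul_varProd_pow I f
  have h := eProd_mul_mul_eProd hN
  refine ⟨N, ⟨_, (f * mulS K n (varProd K I ^ N)).1 1, rfl⟩, ?_, ?_⟩
  · exact mem_coeffIdeal.2 (h ▸ a.mul_mem_right _ _ (a.mul_mem_left _ _ (a.mul_mem_right _ _ hf)))
  · rw [mul_assoc, eProd_mul_mulS_of_fixed (substZero_varProd_pow I N), ← mul_assoc,
      mul_assoc (eProd K I) f]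
    exact h

theorem exists_corner_mul_eq {a : TwoSidedIdeal (SnAlg K n)} (I : Finset (Fin n))
    {f g : SnAlg K n} (hf : f ∈ a) (hg : g ∈ a) :
    ∃ N, ∃ q ∈ coeffIdeal a I * coeffIdeal a I,
      eProd K I * f * eProd K I * g * eProd K I * mulS K n (varProd K I ^ N) =
        mulS K n q.1 * eProd K I := by
  obtain ⟨N, p, hp, hfp⟩ := exists_corner_eq I hf
  obtain ⟨M, q, hq, hgq⟩ := exists_corner_eq I hg
  refine ⟨M + N, p * q, Ideal.mul_mem_mul hp hq, ?_⟩
  have hz := eProd_mul_mulS_of_fixed (substZero_varProd_pow (K := K) I N)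
  have hcomm : Commute (mulS K n q.1) (mulS K n (varProd K I ^ N)) :=
    (Commute.all _ _).map (mulS K n)
  calc eProd K I * f * eProd K I * g * eProd K I * mulS K n (varProd K I ^ (M + N))
      = eProd K I * f * eProd K I * (eProd K I * g * eProd K I * mulS K n (varProd K I ^ M))
          * mulS K n (varProd K I ^ N) := by
        rw [pow_add, map_mul]
        nth_rewrite 2 [← eProd_mul_self]
        simp only [mul_assoc]
    _ = eProd K I * f * eProd K I * mulS K n (varProd K I ^ N) * (mulS K n q.1 * eProd K I) := by
        rw [hgq, mul_assoc _ (mulS K n q.1 * eProd K I), mul_assoc (mulS K n q.1), hz,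
          ← mul_assoc (mulS K n q.1), hcomm.eq]
        simp only [mul_assoc]
    _ = mulS K n (p * q).1 * eProd K I := by
        rw [hfp, mul_assoc, ← mul_assoc (eProd K I),
          eProd_mul_mulS_of_fixed (substZero_of_mem_range q), mul_assoc (mulS K n q.1),
          eProd_mul_self, ← mul_assoc, ← map_mul]
        rfl

/-- The elements `f` of `S_n` that become `q * eProd K I`, with `q` in a given ideal of
polynomials in the variables outside `I`, after right multiplication by a power of
`varProd K I`. -/
def localizedSubgroup (I : Finset (Fin n)) (j : Ideal (substZero K I).range) :
    AddSubgroup (SnAlg K n) where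
  carrier := {f | ∃ N, ∃ q ∈ j, f * mulS K n (varProd K I ^ N) = mulS K n q.1 * eProd K I}
  zero_mem' := ⟨0, 0, j.zero_mem, by simp⟩
  add_mem' := by
    rintro f g ⟨N, p, hp, hf⟩ ⟨M, q, hq, hg⟩
    let z : (substZero K I).range := ⟨varProd K I, _, substZero_varProd I⟩
    have key : ∀ {f : SnAlg K n} {N : ℕ} {p : (substZero K I).range} (M : ℕ),
        f * mulS K n (varProd K I ^ N) = mulS K n p.1 * eProd K I →
        f * mulS K n (varProd K I ^ (N + M)) = mulS K n (p * z ^ M).1 * eProd K I := by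
      intro f N p M h
      rw [pow_add, map_mul, ← mul_assoc, h, mul_assoc,
        eProd_mul_mulS_of_fixed (substZero_varProd_pow I M), ← mul_assoc, ← map_mul]
      rfl
    refine ⟨N + M, p * z ^ M + q * z ^ N, j.add_mem (j.mul_mem_right _ hp) (j.mul_mem_right _ hq),
      ?_⟩
    rw [add_mul, key M hf, add_comm N, key N hg, ← add_mul, ← map_add]
    rfl
  neg_mem' := by
    rintro f ⟨N, p, hp, hf⟩
    refine ⟨N, -p, j.neg_mem hp, ?_⟩
    rw [neg_mul, hf, ← neg_mul, ← map_neg]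
    rfl

theorem corner_mem_localizedSubgroup {a : TwoSidedIdeal (SnAlg K n)} (haidem : tsiMul a a = a)
    (I : Finset (Fin n)) {f : SnAlg K n} (hf : f ∈ a) :
    eProd K I * f * eProd K I ∈ localizedSubgroup I (coeffIdeal a I * coeffIdeal a I) := by
  set H := localizedSubgroup I (coeffIdeal a I * coeffIdeal a I)
  rw [← haidem] at hf
  refine span_induction_add (p := fun f => eProd K I * f * eProd K I ∈ H) ?_ ?_ ?_ ?_ f hf
  · simp [H.zero_mem]
  · intro f g hf hg
    rw [mul_add, add_mul]
    exact H.add_mem hf hg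
  · intro f hf
    rw [mul_neg, neg_mul]
    exact H.neg_mem hf
  rintro _ ⟨x, hx, y, hy, rfl⟩ s t
  obtain ⟨u, hu, hxu⟩ := hasRightUnits_innerIdeal I (eProd K I * (s * x))
    ((innerIdeal K I).mul_mem_right _ _ (eProd_mem_innerIdeal I))
  have key : ∀ u ∈ TwoSidedIdeal.span {eProd K I},
      eProd K I * (s * x) * u * (y * t) * eProd K I ∈ H := by
    refine span_induction_add ?_ ?_ ?_ ?_
    · simp [H.zero_mem]
    · intro f g hf hg
      rw [mul_add, add_mul, add_mul]
      exact H.add_mem hf hg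
    · intro f hf
      rw [mul_neg, neg_mul, neg_mul]
      exact H.neg_mem hf
    · rintro _ rfl s' t'
      have : _ ∈ H := exists_corner_mul_eq I (a.mul_mem_right _ s' (a.mul_mem_left s _ hx))
        (a.mul_mem_left t' _ (a.mul_mem_right _ t hy))
      simpa only [mul_assoc] using this
  have := key u (innerIdeal_le_span I hu)
  rw [hxu] at this
  simpa only [mul_assoc] using this

theorem eProd_mem_or_le_outerIdeal {a : TwoSidedIdeal (SnAlg K n)} (haidem : tsiMul a a = a)
    (I : Finset (Fin n)) : eProd K I ∈ a ∨ a ≤ outerIdeal K I := by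
  let z : (substZero K I).range := ⟨varProd K I, _, substZero_varProd I⟩
  have hz : z ≠ 0 := fun h => varProd_ne_zero I (congrArg Subtype.val h)
  have hpow : ∀ q ∈ coeffIdeal a I, ∃ N, z ^ N * q ∈ coeffIdeal a I * coeffIdeal a I := by
    intro q hq
    have hmem := corner_mem_localizedSubgroup haidem I (mem_coeffIdeal.1 hq)
    rw [← mul_assoc, eProd_mul_mulS_of_fixed (substZero_of_mem_range q), mul_assoc, mul_assoc,
      eProd_mul_self, eProd_mul_self] at hmem
    obtain ⟨N, p, hp, hpq⟩ := hmem
    rw [mul_assoc, eProd_mul_mulS_of_fixed (substZero_varProd_pow I N), ← mul_assoc,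
      ← map_mul, mul_comm] at hpq
    refine ⟨N, ?_⟩
    convert hp
    exact Subtype.ext (mulS_mul_eProd_injective hpq)
  rcases Ideal.eq_bot_or_exists_pow_mem (j := coeffIdeal a I) hz hpow with h | ⟨N, hN⟩
  · right
    intro f hf
    by_contra hfI
    obtain ⟨s, t, q, hq, hqI, hq0⟩ := exists_mul_mul_eq_of_notMem_outerIdeal hfI
    have hmem : (⟨q, q, hqI⟩ : (substZero K I).range) ∈ coeffIdeal a I := by
      rw [mem_coeffIdeal, ← hq]
      exact a.mul_mem_right _ _ (a.mul_mem_left _ _ hf)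
    rw [h, Ideal.mem_bot] at hmem
    exact hq0 (congrArg Subtype.val hmem)
  · left
    obtain ⟨v, hv, -⟩ := exists_mulS_varProd_pow_mul_eq_one (K := K) I N
    rw [mem_coeffIdeal] at hN
    have := a.mul_mem_left v _ hN
    rw [← mul_assoc] at this
    change v * mulS K n (varProd K I ^ N) * _ ∈ a at this
    rwa [hv, one_mul] at this

theorem sInf_outerIdeal_le {a : TwoSidedIdeal (SnAlg K n)} (haidem : tsiMul a a = a) :
    sInf {P | ∃ I : Finset (Fin n), a ≤ outerIdeal K I ∧ P = outerIdeal K I} ≤ a := by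
  set c := sInf {P | ∃ I : Finset (Fin n), a ≤ outerIdeal K I ∧ P = outerIdeal K I}
  suffices h : ∀ J I : Finset (Fin n), Iᶜ = J → innerIdeal K I ⊓ c ≤ a by
    refine le_trans (le_inf ?_ le_rfl) (h _ ∅ rfl)
    exact le_top
  intro J
  induction J using Finset.strongInduction with
  | H J ih =>
  rintro I rfl
  rcases eProd_mem_or_le_outerIdeal haidem I with h | h
  · refine inf_le_left.trans ((innerIdeal_le_span I).trans (TwoSidedIdeal.span_le.2 ?_))
    simpa using h
  · have hcI : c ≤ outerIdeal K I := sInf_le ⟨I, h, rfl⟩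
    intro f hf
    obtain ⟨hfI, hfc⟩ := (TwoSidedIdeal.mem_inf _).1 hf
    obtain ⟨u, hu, hfu⟩ := hasRightUnits_outerIdeal I f (hcI hfc)
    rw [← hfu]
    refine mul_mem_of_mem_span ?_ u hu
    rintro _ ⟨j, hj, rfl⟩ s
    refine ih (insert j I)ᶜ ?_ _ rfl ?_
    · exact compl_lt_compl_iff_lt.2 (Finset.ssubset_insert hj)
    · rw [innerIdeal_insert, TwoSidedIdeal.mem_inf, TwoSidedIdeal.mem_inf]
      refine ⟨⟨TwoSidedIdeal.mul_mem_left _ _ _ (eS_mem_outerIdeal (by simp)), ?_⟩, ?_⟩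
      · exact TwoSidedIdeal.mul_mem_right _ _ _ (TwoSidedIdeal.mul_mem_right _ _ _ hfI)
      · exact TwoSidedIdeal.mul_mem_right _ _ _ (TwoSidedIdeal.mul_mem_right _ _ _ hfc)


end OneSidedInverses

/-- an idempotent proper two-sided ideal `a` of `S_n` has all its minimal primes
idempotent, and `a` is both the product and the intersection of its minimal primes; moreover
these presentations are unique: any presentation of `a` as a product (resp. an intersection)
of pairwise incomparable idempotent primes uses exactly the set `Min(a)`. -/
theorem statement14 (K : Type u) [Field K] (n : ℕ) (hn : 0 < n)
    (a : TwoSidedIdeal (SnAlg K n)) (haidem : tsiMul a a = a) (ha : a ≠ ⊤) :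
    (∀ P ∈ minPrimesOver a, tsiMul P P = P) ∧
    (∃ l : List (TwoSidedIdeal (SnAlg K n)), l.Nodup ∧ {P | P ∈ l} = minPrimesOver a ∧
      a = l.foldr tsiMul ⊤) ∧
    a = sInf (minPrimesOver a) ∧
    (∀ l : List (TwoSidedIdeal (SnAlg K n)),
      (∀ q ∈ l, tsiPrime q ∧ tsiMul q q = q) →
      l.Pairwise (fun p q => ¬ p ≤ q ∧ ¬ q ≤ p) →
      a = l.foldr tsiMul ⊤ → {P | P ∈ l} = minPrimesOver a) ∧
    (∀ l : List (TwoSidedIdeal (SnAlg K n)),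
      (∀ q ∈ l, tsiPrime q ∧ tsiMul q q = q) →
      l.Pairwise (fun p q => ¬ p ≤ q ∧ ¬ q ≤ p) →
      a = sInf {P | P ∈ l} → {P | P ∈ l} = minPrimesOver a) := by
  exact minPrimesOver_of_sInf_primes tsiPrime_outerIdeal hasRightUnits_outerIdeal
    (fun _ => sInf_outerIdeal_le) haidem
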